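/- arXiv:2101.00700 — 6 statements merged into one kernel-verified Lean document; each statement's English description precedes it below -/
import Mathlib

section
/- Let {E_1,…,E_k} be a COSI set of complex n×n matrices, let f : {1,…,k}×{1,…,k} → {1,…,k} be a Latin square (each index appears exactly once in each row and once in each column), and let α_{ij} (1 ≤ i,j ≤ k) be complex numbers with |α_{ij}| = 1. Then the kn×kn block matrix G whose (i,j) block is α_{ij}·E_{f(i,j)} satisfies G·Gᴴ = I_{kn}, i.e. G is a unitary matrix. -/
open Matrix

/-- A Latin-square block arrangement of a COSI set with unimodular values attached
is a unitary matrix. -/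
theorem cosi_latin_square_unimodular_unitary (n k : ℕ)
    (E : Fin k → Matrix (Fin n) (Fin n) ℂ)
    (hherm : ∀ i, (E i)ᴴ = E i)
    (hidem : ∀ i, E i * E i = E i)
    (horth : ∀ i j, i ≠ j → E i * E j = 0)
    (hsum : ∑ i, E i = 1)
    (f : Fin k → Fin k → Fin k)
    (hrow : ∀ i, Function.Bijective (fun j => f i j))
    (hcol : ∀ j, Function.Bijective (fun i => f i j))
    (α : Fin k → Fin k → ℂ)
    (hα : ∀ i j, ‖α i j‖ = 1)
    (G : Matrix (Fin k × Fin n) (Fin k × Fin n) ℂ)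
    (hG : ∀ p q, G p q = α p.1 q.1 * E (f p.1 q.1) p.2 q.2) :
    G * Gᴴ = 1 := by
  ext ⟨i, a⟩ ⟨i', b⟩
  have key : (G * Gᴴ) (i, a) (i', b)
      = ∑ j, (α i j * star (α i' j)) * (E (f i j) * E (f i' j)) a b := by
    rw [Matrix.mul_apply, Fintype.sum_prod_type]
    refine Finset.sum_congr rfl fun j _ => ?_
    rw [Matrix.mul_apply, Finset.mul_sum]
    refine Finset.sum_congr rfl fun c _ => ?_
    have h : star (E (f i' j) b c) = E (f i' j) c b := by
      rw [← Matrix.conjTranspose_apply, hherm]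
    rw [Matrix.conjTranspose_apply, hG, hG, star_mul']
    simp only [h]
    ring
  rw [key]
  by_cases hi : i = i'
  · subst hi
    have h1 : ∀ j, (α i j * star (α i j)) * (E (f i j) * E (f i j)) a b = E (f i j) a b := by
      intro j
      have : α i j * star (α i j) = 1 := by
        have h2 := Complex.mul_conj' (α i j)
        rw [hα] at h2
        simpa using h2
      rw [this, hidem, one_mul]
    rw [Finset.sum_congr rfl fun j _ => h1 j,
      (hrow i).sum_comp (fun m => E m a b), ← Matrix.sum_apply, hsum]
    simp [Matrix.one_apply]
  · rw [Finset.sum_eq_zero, Matrix.one_apply_ne]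
    · intro h
      exact hi (congrArg Prod.fst h)
    · intro j _
      rw [horth _ _ fun h => hi ((hcol j).injective h)]
      simp
end

section
/- Let A_1,…,A_k be complex m×m Hadamard matrices (every entry has modulus 1 and A_j·A_jᴴ = m·I_m), and let U = (u_{ij}) be a complex k×k Hadamard matrix (every entry has modulus 1 and U·Uᴴ = k·I_k). Then both the left matrix tangle product (U;A_1,…,A_k), whose (i,j) block is u_{ij}·A_j, and the right matrix tangle product (A_1,…,A_k;U), whose (i,j) block is u_{ij}·A_i, are km×km Hadamard matrices: every entry has modulus 1 and T·Tᴴ = km·I_{km}. Moreover, if every entry of each A_j and of U is a p-th root of unity, then every entry of these tangle products is a p-th root of unity. -/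
open Matrix

/-- Both tangle products of complex Hadamard matrices are Hadamard; moreover the
property of entries being p-th roots of unity is preserved. -/
theorem tangle_product_hadamard (m k p : ℕ)
    (A : Fin k → Matrix (Fin m) (Fin m) ℂ)
    (hAmod : ∀ j a b, ‖A j a b‖ = 1)
    (hA : ∀ j, A j * (A j)ᴴ = (m : ℂ) • 1)
    (U : Matrix (Fin k) (Fin k) ℂ)
    (hUmod : ∀ a b, ‖U a b‖ = 1)
    (hU : U * Uᴴ = (k : ℂ) • 1)
    (L : Matrix (Fin k × Fin m) (Fin k × Fin m) ℂ)
    (hL : ∀ q r, L q r = U q.1 r.1 * A r.1 q.2 r.2)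
    (Rt : Matrix (Fin k × Fin m) (Fin k × Fin m) ℂ)
    (hR : ∀ q r, Rt q r = U q.1 r.1 * A q.1 q.2 r.2) :
    (∀ q r, ‖L q r‖ = 1) ∧ L * Lᴴ = ((k * m : ℕ) : ℂ) • 1 ∧
    (∀ q r, ‖Rt q r‖ = 1) ∧ Rt * Rtᴴ = ((k * m : ℕ) : ℂ) • 1 ∧
    ((∀ j a b, (A j a b) ^ p = 1) → (∀ a b, (U a b) ^ p = 1) →
      (∀ q r, (L q r) ^ p = 1) ∧ (∀ q r, (Rt q r) ^ p = 1)) := by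
  have hA' : ∀ j a b, ∑ c, A j a c * star (A j b c) = if a = b then (m : ℂ) else 0 := by
    intro j a b
    have h := congrFun (congrFun (hA j) a) b
    simpa [Matrix.mul_apply, Matrix.one_apply] using h
  have hU' : ∀ a b, ∑ c, U a c * star (U b c) = if a = b then (k : ℂ) else 0 := by
    intro a b
    have h := congrFun (congrFun hU a) b
    simpa [Matrix.mul_apply, Matrix.one_apply] using h
  refine ⟨?_, ?_, ?_, ?_, ?_⟩
  · intro q r
    rw [hL, norm_mul, hUmod, hAmod, one_mul]
  · ext ⟨i, a⟩ ⟨j, b⟩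
    have h : (L * Lᴴ) (i, a) (j, b)
        = ∑ l, (U i l * star (U j l)) * ∑ c, A l a c * star (A l b c) := by
      rw [Matrix.mul_apply, Fintype.sum_prod_type]
      refine Finset.sum_congr rfl fun l _ => ?_
      rw [Finset.mul_sum]
      refine Finset.sum_congr rfl fun c _ => ?_
      rw [Matrix.conjTranspose_apply, hL, hL, star_mul']
      ring
    rw [h]
    simp_rw [hA']
    rw [← Finset.sum_mul, hU', Matrix.smul_apply, Matrix.one_apply]
    by_cases h1 : i = j <;> by_cases h2 : a = b <;> simp [h1, h2]
  · intro q r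
    rw [hR, norm_mul, hUmod, hAmod, one_mul]
  · ext ⟨i, a⟩ ⟨j, b⟩
    have h : (Rt * Rtᴴ) (i, a) (j, b)
        = (∑ l, (U i l * star (U j l))) * ∑ c, A i a c * star (A j b c) := by
      rw [Matrix.mul_apply, Fintype.sum_prod_type, Finset.sum_mul]
      refine Finset.sum_congr rfl fun l _ => ?_
      rw [Finset.mul_sum]
      refine Finset.sum_congr rfl fun c _ => ?_
      rw [Matrix.conjTranspose_apply, hR, hR, star_mul']
      ring
    rw [h, hU', Matrix.smul_apply, Matrix.one_apply]
    by_cases h1 : i = j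
    · subst h1
      rw [hA']
      by_cases h2 : a = b <;> simp [h2]
    · simp [h1]
  · intro h1 h2
    exact ⟨fun q r => by rw [hL, mul_pow, h1, h2, one_mul],
      fun q r => by rw [hR, mul_pow, h1, h2, one_mul]⟩
end

section
/- Let A_1,…,A_k be unitary complex t×t matrices and let V and W be arbitrary complex k×k matrices. For a k×k matrix M = (m_{ij}) let T_M = (M;A_1,…,A_k) denote the left matrix tangle product, i.e. the kt×kt block matrix whose (i,j) block is m_{ij}·A_j. Then |det(T_V − T_W)| = |det(V − W)|^{t}. (Consequently, if {U_1,…,U_s} is a constellation of k×k unitary matrices of quality ζ, then {(U_i;A_1,…,A_k) : i = 1,…,s} is a constellation of kt×kt unitary matrices of the same quality ζ.) -/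
open Matrix

/-- If A₁,…,A_k are unitary t×t matrices, then for any k×k matrices V, W the left
tangle products satisfy |det(T_V − T_W)| = |det(V − W)|^t; hence tangling a
constellation with unitary matrices preserves its quality. -/
theorem tangle_product_constellation_quality (t k : ℕ)
    (A : Fin k → Matrix (Fin t) (Fin t) ℂ)
    (hA : ∀ j, A j * (A j)ᴴ = 1)
    (V W : Matrix (Fin k) (Fin k) ℂ)
    (TV TW : Matrix (Fin k × Fin t) (Fin k × Fin t) ℂ)
    (hTV : ∀ p q, TV p q = V p.1 q.1 * A q.1 p.2 q.2)
    (hTW : ∀ p q, TW p q = W p.1 q.1 * A q.1 p.2 q.2) :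
    ‖(TV - TW).det‖ = ‖(V - W).det‖ ^ t := by
  have hfac : TV - TW = Matrix.kroneckerMap (fun x y => x * y) (V - W) (1 : Matrix (Fin t) (Fin t) ℂ) *
      (blockDiagonal A).submatrix (Equiv.prodComm _ _) (Equiv.prodComm _ _) := by
    ext ⟨i, a⟩ ⟨j, b⟩
    rw [Matrix.sub_apply, hTV, hTW, Matrix.mul_apply, Fintype.sum_prod_type]
    simp [ Matrix.one_apply, blockDiagonal_apply, sub_mul]
  have hdet : ∀ j, ‖(A j).det‖ = 1 := by
    intro j
    have h := congrArg (fun M => ‖Matrix.det M‖) (hA j)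
    simp only [det_mul, det_conjTranspose, norm_mul, norm_star, det_one, norm_one] at h
    nlinarith [norm_nonneg (A j).det]
  rw [hfac, det_mul, det_kronecker, det_submatrix_equiv_self, det_blockDiagonal]
  simp [hdet]
end

section
/- Let {E_0,E_1,…,E_{n−1}} be a COSI set of complex n×n matrices and let α_0,α_1,…,α_{n−1} be complex numbers. Let G be the n²×n² block matrix whose (i,j) block (indices taken in {0,1,…,n−1}) is α_j·E_{(j−i) mod n}, so that row i of blocks is E_{−i}α_0, E_{1−i}α_1, …, E_{n−1−i}α_{n−1} with subscripts mod n. Then |det G| = |α_0·α_1⋯α_{n−1}|^{n}. -/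
open Matrix

/-- For a COSI set {E₀,…,E_{n−1}} of n×n matrices and complex numbers α₀,…,α_{n−1},
the block matrix G whose (i,j) block is α_j·E_{(j−i) mod n} satisfies
|det G| = |α₀·α₁⋯α_{n−1}|ⁿ. -/
theorem abs_det_circulant_cosi_block (n : ℕ)
    (E : Fin n → Matrix (Fin n) (Fin n) ℂ)
    (hherm : ∀ i, (E i)ᴴ = E i)
    (hidem : ∀ i, E i * E i = E i)
    (horth : ∀ i j, i ≠ j → E i * E j = 0)
    (hsum : ∑ i, E i = 1)
    (α : Fin n → ℂ)
    (G : Matrix (Fin n × Fin n) (Fin n × Fin n) ℂ)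
    (hG : ∀ p q, G p q = α q.1 * E (q.1 - p.1) p.2 q.2) :
    ‖G.det‖ = ‖∏ j, α j‖ ^ n := by
  rcases Nat.eq_zero_or_pos n with h0 | hpos
  · subst h0
    simp
  haveI : NeZero n := ⟨hpos.ne'⟩
  let U : Matrix (Fin n × Fin n) (Fin n × Fin n) ℂ :=
    Matrix.of fun p q => E (q.1 - p.1) p.2 q.2
  have hGU : G = U * Matrix.diagonal (fun q : Fin n × Fin n => α q.1) := by
    ext p q
    rw [Matrix.mul_diagonal, hG, mul_comm]
    rfl
  have hU : U * Uᴴ = 1 := by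
    ext p r
    have h1 : (U * Uᴴ) p r = ∑ a, (E (a - p.1) * E (a - r.1)) p.2 r.2 := by
      rw [Matrix.mul_apply, Fintype.sum_prod_type]
      refine Finset.sum_congr rfl fun a _ => ?_
      rw [Matrix.mul_apply]
      refine Finset.sum_congr rfl fun b _ => ?_
      have h2 := congrFun (congrFun (hherm (a - r.1)) b) r.2
      rw [Matrix.conjTranspose_apply] at h2
      rw [Matrix.conjTranspose_apply, ← h2]
      rfl
    rw [h1]
    obtain ⟨p1, p2⟩ := p
    obtain ⟨r1, r2⟩ := r
    by_cases h : p1 = r1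
    · subst h
      simp only [hidem]
      have h3 : ∑ a, E (a - p1) p2 r2 = ∑ a, E a p2 r2 :=
        (Equiv.subRight p1).sum_comp (fun a => E a p2 r2)
      rw [h3, ← Matrix.sum_apply, hsum]
      simp [Matrix.one_apply]
    · have h4 : ∀ a, E (a - p1) * E (a - r1) = 0 := fun a =>
        horth _ _ fun hh => h (sub_right_injective hh)
      simp [h4, Matrix.one_apply, h]
  have hdet : ‖U.det‖ = 1 := by
    have h5 := congrArg (fun M => ‖Matrix.det M‖) hU
    simp only [Matrix.det_mul, Matrix.det_conjTranspose, Matrix.det_one, norm_mul, norm_star,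
      norm_one] at h5
    nlinarith [norm_nonneg U.det]
  rw [hGU, Matrix.det_mul, norm_mul, hdet, one_mul, Matrix.det_diagonal, Fintype.prod_prod_type]
  simp [Finset.prod_pow]
end

section
/- Let α_1, α_2, α_3 be arbitrary real numbers and set α_4 = α_1 + α_2, α_5 = −α_1 − α_3, α_6 = α_2 − α_3. Define the complex 4×4 matrix H with rows (1, e^{iα_1}, −e^{−iα_2}, −e^{−iα_3}), (−e^{−iα_1}, 1, −e^{−iα_4}, e^{iα_5}), (e^{iα_2}, e^{iα_4}, 1, e^{iα_6}), (e^{iα_3}, −e^{−iα_5}, −e^{−iα_6}, 1). Then H is a complex skew Hadamard matrix: every entry of H has modulus 1, H·Hᴴ = 4·I_4, and H + Hᴴ = 2·I_4. -/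
open Matrix

/-- The explicit 4×4 matrix with phase entries determined by α₁, α₂, α₃ (and
α₄ = α₁+α₂, α₅ = −α₁−α₃, α₆ = α₂−α₃) is a complex skew Hadamard matrix. -/
theorem explicit_complex_skew_hadamard (α₁ α₂ α₃ : ℝ)
    (α₄ α₅ α₆ : ℝ)
    (hα₄ : α₄ = α₁ + α₂) (hα₅ : α₅ = -α₁ - α₃) (hα₆ : α₆ = α₂ - α₃)
    (H : Matrix (Fin 4) (Fin 4) ℂ)
    (hH : H = !![1, Complex.exp (α₁ * Complex.I), -Complex.exp (-α₂ * Complex.I),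
        -Complex.exp (-α₃ * Complex.I);
      -Complex.exp (-α₁ * Complex.I), 1, -Complex.exp (-α₄ * Complex.I),
        Complex.exp (α₅ * Complex.I);
      Complex.exp (α₂ * Complex.I), Complex.exp (α₄ * Complex.I), 1,
        Complex.exp (α₆ * Complex.I);
      Complex.exp (α₃ * Complex.I), -Complex.exp (-α₅ * Complex.I),
        -Complex.exp (-α₆ * Complex.I), 1]) :
    (∀ a b, ‖H a b‖ = 1) ∧ H * Hᴴ = (4 : ℂ) • 1 ∧ H + Hᴴ = (2 : ℂ) • 1 := by
  subst hα₄ hα₅ hα₆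
  have e1 : ∀ t : ℝ, ‖Complex.exp (t * Complex.I)‖ = 1 := Complex.norm_exp_ofReal_mul_I
  have e2 : ∀ t : ℝ, ‖Complex.exp (-t * Complex.I)‖ = 1 := by
    intro t
    have := e1 (-t)
    rwa [Complex.ofReal_neg] at this
  have c1 : ∀ t : ℝ, (starRingEnd ℂ) (Complex.exp (t * Complex.I))
      = Complex.exp (-t * Complex.I) := by
    intro t
    rw [← Complex.exp_conj]; simp
  have c2 : ∀ t : ℝ, (starRingEnd ℂ) (Complex.exp (-t * Complex.I))
      = Complex.exp (t * Complex.I) := by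
    intro t
    rw [← Complex.exp_conj]; simp
  have m : ∀ t : ℝ, Complex.exp (t * Complex.I) * Complex.exp (-t * Complex.I) = 1 := by
    intro t
    rw [← Complex.exp_add, neg_mul, add_neg_cancel, Complex.exp_zero]
  have a4 : Complex.exp ((α₁ + α₂ : ℝ) * Complex.I)
      = Complex.exp (α₁ * Complex.I) * Complex.exp (α₂ * Complex.I) := by
    rw [← Complex.exp_add]; congr 1; push_cast; ring
  have b4 : Complex.exp (-(α₁ + α₂ : ℝ) * Complex.I)
      = Complex.exp (-α₁ * Complex.I) * Complex.exp (-α₂ * Complex.I) := by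
    rw [← Complex.exp_add]; congr 1; push_cast; ring
  have a5 : Complex.exp ((-α₁ - α₃ : ℝ) * Complex.I)
      = Complex.exp (-α₁ * Complex.I) * Complex.exp (-α₃ * Complex.I) := by
    rw [← Complex.exp_add]; congr 1; push_cast; ring
  have b5 : Complex.exp (-(-α₁ - α₃ : ℝ) * Complex.I)
      = Complex.exp (α₁ * Complex.I) * Complex.exp (α₃ * Complex.I) := by
    rw [← Complex.exp_add]; congr 1; push_cast; ring
  have a6 : Complex.exp ((α₂ - α₃ : ℝ) * Complex.I)
      = Complex.exp (α₂ * Complex.I) * Complex.exp (-α₃ * Complex.I) := by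
    rw [← Complex.exp_add]; congr 1; push_cast; ring
  have b6 : Complex.exp (-(α₂ - α₃ : ℝ) * Complex.I)
      = Complex.exp (-α₂ * Complex.I) * Complex.exp (α₃ * Complex.I) := by
    rw [← Complex.exp_add]; congr 1; push_cast; ring
  rw [a4, b4, a5, b5, a6, b6] at hH
  have p1 := e1 α₁
  have p2 := e1 α₂
  have p3 := e1 α₃
  have q1 := e2 α₁
  have q2 := e2 α₂
  have q3 := e2 α₃
  have r1 := c1 α₁
  have r2 := c1 α₂
  have r3 := c1 α₃
  have s1 := c2 α₁
  have s2 := c2 α₂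
  have s3 := c2 α₃
  have m1 := m α₁
  have m2 := m α₂
  have m3 := m α₃
  clear a4 b4 a5 b5 a6 b6 e1 e2 c1 c2 m
  generalize Complex.exp (α₁ * Complex.I) = x at *
  generalize Complex.exp (α₂ * Complex.I) = y at *
  generalize Complex.exp (α₃ * Complex.I) = z at *
  generalize Complex.exp (-α₁ * Complex.I) = x' at *
  generalize Complex.exp (-α₂ * Complex.I) = y' at *
  generalize Complex.exp (-α₃ * Complex.I) = z' at *
  subst hH
  refine ⟨?_, ?_, ?_⟩
  · intro a b
    fin_cases a <;> fin_cases b <;> simp [p1, p2, p3, q1, q2, q3]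
  · ext a b
    fin_cases a <;> fin_cases b <;>
      simp [Matrix.mul_apply, Fin.sum_univ_four, r1, r2, r3, s1, s2, s3] <;> grind
  · ext a b
    fin_cases a <;> fin_cases b <;>
      simp [r1, r2, r3, s1, s2, s3] <;> norm_num
end

section
/- Let H be a complex n×n Hadamard matrix (every entry has modulus 1 and H·Hᴴ = n·I_n) with columns h_1,…,h_n, and set E_i = (1/n)·h_i·h_iᴴ for i = 1,…,n. Let L be the n²×n² block matrix whose (i,j) block (indices taken in {0,1,…,n−1}) is n·E_{(i+j) mod n} (the reverse circulant block arrangement, scaled by n). Then L is a symmetric complex n²×n² Hadamard matrix: Lᴴ = L, every entry of L has modulus 1, and L·Lᴴ = n²·I_{n²}. Moreover, if every entry of H is a p-th root of unity, then every entry of L is a p-th root of unity, so L is a symmetric Hadamard matrix of type H(n²,p). -/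
open Matrix

/-- From a complex n×n Hadamard matrix H with columns h_i, form the COSI set
E_i = (1/n)·h_i·h_iᴴ and the reverse-circulant block matrix L whose (i,j) block is
n·E_{(i+j) mod n}. Then L is a symmetric n²×n² Hadamard matrix, and if the entries
of H are p-th roots of unity then so are the entries of L. -/
theorem reverse_circulant_symmetric_hadamard (n p : ℕ)
    (H : Matrix (Fin n) (Fin n) ℂ)
    (hmod : ∀ a b, ‖H a b‖ = 1)
    (hHad : H * Hᴴ = (n : ℂ) • 1)
    (E : Fin n → Matrix (Fin n) (Fin n) ℂ)
    (hE : ∀ i a b, E i a b = (1 / (n : ℂ)) * (H a i * star (H b i)))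
    (L : Matrix (Fin n × Fin n) (Fin n × Fin n) ℂ)
    (hL : ∀ q r, L q r = (n : ℂ) * E (q.1 + r.1) q.2 r.2) :
    Lᴴ = L ∧ (∀ q r, ‖L q r‖ = 1) ∧
      L * Lᴴ = ((n ^ 2 : ℕ) : ℂ) • 1 ∧
      ((∀ a b, (H a b) ^ p = 1) → ∀ q r, (L q r) ^ p = 1) := by
  rcases Nat.eq_zero_or_pos n with h0 | hpos
  · subst h0
    refine ⟨?_, fun q => q.1.elim0, ?_, fun _ q => q.1.elim0⟩
    · ext q
      exact q.1.elim0
    · ext q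
      exact q.1.elim0
  obtain ⟨m, rfl⟩ : ∃ m, n = m + 1 := ⟨n - 1, by omega⟩
  generalize hN : ((m + 1 : ℕ) : ℂ) = N at *
  have hN0 : N ≠ 0 := by
    rw [← hN]
    exact Nat.cast_ne_zero.mpr (Nat.succ_ne_zero m)
  have hL' : ∀ q r, L q r = H q.2 (q.1 + r.1) * star (H r.2 (q.1 + r.1)) := by
    intro q r
    rw [hL, hE]
    field_simp
  have hsym : Lᴴ = L := by
    ext q r
    rw [conjTranspose_apply, hL', hL', star_mul, star_star, add_comm r.1 q.1]
  have hHad2 : Hᴴ * H = N • 1 := by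
    have h1 : H * (N⁻¹ • Hᴴ) = 1 := by
      rw [Matrix.mul_smul, hHad, smul_smul, inv_mul_cancel₀ hN0, one_smul]
    have h2 := mul_eq_one_comm.mp h1
    rw [Matrix.smul_mul] at h2
    rw [← h2, smul_smul, mul_inv_cancel₀ hN0, one_smul]
  have hrow : ∀ a b, ∑ j, H a j * star (H b j) = if a = b then N else 0 := by
    intro a b
    have := congrFun (congrFun hHad a) b
    simpa [Matrix.mul_apply, Matrix.one_apply] using this
  have hcol : ∀ i k, ∑ c, star (H c i) * H c k = if i = k then N else 0 := by
    intro a b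
    have := congrFun (congrFun hHad2 a) b
    simpa [Matrix.mul_apply, Matrix.one_apply] using this
  refine ⟨hsym, ?_, ?_, ?_⟩
  · intro q r
    rw [hL', norm_mul, norm_star, hmod, hmod, one_mul]
  · ext ⟨i, a⟩ ⟨k, b⟩
    rw [Matrix.mul_apply, Fintype.sum_prod_type]
    have key : ∀ j, ∑ c, L (i, a) (j, c) * Lᴴ (j, c) (k, b)
        = if i = k then N * (H a (i + j) * star (H b (i + j))) else 0 := by
      intro j
      have h1 : ∀ c, L (i, a) (j, c) * Lᴴ (j, c) (k, b)
          = (H a (i + j) * star (H b (k + j))) * (star (H c (i + j)) * H c (k + j)) := by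
        intro c
        rw [conjTranspose_apply, hL', hL', star_mul, star_star]
        ring
      simp only [h1]
      rw [← Finset.mul_sum, hcol]
      by_cases h : i = k
      · subst h
        simp [mul_comm]
      · simp [h]
    simp only [key]
    by_cases h : i = k
    · subst h
      simp only [if_true]
      have hshift : ∑ j, H a (i + j) * star (H b (i + j)) = ∑ j, H a j * star (H b j) :=
        Equiv.sum_comp (Equiv.addLeft i) (fun j => H a j * star (H b j))
      rw [← Finset.mul_sum, hshift, hrow, Matrix.smul_apply, Matrix.one_apply, Nat.cast_pow, hN]
      by_cases hab : a = b
      · subst hab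
        simp [sq]
      · simp [hab]
    · simp [h]
  · intro hp q r
    rw [hL', mul_pow, ← star_pow, hp, hp, star_one, one_mul]
end
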